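/- arXiv:1511.06441 — 2 statements merged into one kernel-verified Lean document; each statement's English description precedes it below -/
import Mathlib

section
/- For all integers k ≥ 1 and T with 2k ≤ T, every path starting on the x-axis and ending at the vertex (k, T − 2k) has total passage time at least min(T, 2(T − 2k)). -/
/-- Two lattice points are adjacent iff they differ by 1 in exactly one coordinate. -/
def LatticeAdj (p q : ℤ × ℤ) : Prop := |p.1 - q.1| + |p.2 - q.2| = 1

/-- The passage time of the edge between `p` and `q`: 1 if both endpoints lie on the
y-axis, and 2 otherwise. -/
def edgeTime (p q : ℤ × ℤ) : ℤ := if p.1 = 0 ∧ q.1 = 0 then 1 else 2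

/-- `π : Fin (n+1) → ℤ × ℤ` is a path if consecutive vertices are adjacent. -/
def IsLatticePath (n : ℕ) (π : Fin (n + 1) → ℤ × ℤ) : Prop :=
  ∀ i : Fin n, LatticeAdj (π i.castSucc) (π i.succ)

/-- The total passage time of a path. -/
def totalTime (n : ℕ) (π : Fin (n + 1) → ℤ × ℤ) : ℤ :=
  ∑ i : Fin n, edgeTime (π i.castSucc) (π i.succ)

/-- Potential function. -/
def pot (p : ℤ × ℤ) : ℤ := min (2 * |p.1| + |p.2|) (2 * |p.2|)

lemma pot_step (p q : ℤ × ℤ) (h : LatticeAdj p q) : pot q ≤ pot p + edgeTime p q := by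
  obtain ⟨a, b⟩ := p
  obtain ⟨c, d⟩ := q
  simp only [LatticeAdj, pot, edgeTime] at *
  split_ifs with h0
  · obtain ⟨rfl, rfl⟩ := h0
    simp only [abs] at *
    omega
  · simp only [abs] at *
    omega

lemma pot_path (n : ℕ) (π : Fin (n + 1) → ℤ × ℤ) (h : IsLatticePath n π) :
    pot (π (Fin.last n)) ≤ pot (π 0) + totalTime n π := by
  induction n with
  | zero => simp [totalTime]
  | succ m ih =>
    have h1 := ih (fun i => π i.castSucc) (fun i => h i.castSucc)
    have h2 := pot_step _ _ (h (Fin.last m))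
    have h3 : totalTime (m + 1) π = totalTime m (fun i => π i.castSucc)
        + edgeTime (π (Fin.last m).castSucc) (π (Fin.last m).succ) := by
      simp only [totalTime]
      rw [Fin.sum_univ_castSucc]
      rfl
    rw [h3]
    simp only [Fin.succ_last, Fin.castSucc_zero] at *
    linarith

/-- For all integers k ≥ 1 and T with 2k ≤ T, every path starting on the
x-axis and ending at the vertex (k, T − 2k) has total passage time at least
min(T, 2(T − 2k)). -/
theorem stmt_12 (k T : ℤ) (hk : 1 ≤ k) (hkT : 2 * k ≤ T)
    (n : ℕ) (π : Fin (n + 1) → ℤ × ℤ)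
    (hpath : IsLatticePath n π) (hstart : (π 0).2 = 0)
    (hend : π (Fin.last n) = (k, T - 2 * k)) :
    min T (2 * (T - 2 * k)) ≤ totalTime n π := by
  have h := pot_path n π hpath
  rw [hend] at h
  have h0 : pot (π 0) = 0 := by
    simp [pot, hstart]
  rw [h0, zero_add] at h
  refine le_trans (le_of_eq ?_) h
  simp only [pot]
  rw [abs_of_nonneg (by omega : 0 ≤ k), abs_of_nonneg (by omega : 0 ≤ T - 2 * k)]
  congr 1
  ring
end

section
/- For all integers k and T with 1 ≤ k and 4k ≤ T, the minimum, over all paths starting on the x-axis and ending at the vertex (k, T − 2k), of the total passage time equals T; that is, there is such a path of total passage time T and every such path has total passage time at least T. -/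
def potl (p : ℤ × ℤ) : ℤ := min (2 * |p.2|) (|p.2| + 2 * |p.1|)

theorem potl_step (p q : ℤ × ℤ) (h : LatticeAdj p q) : potl q ≤ potl p + edgeTime p q := by
  obtain ⟨a, b⟩ := p
  obtain ⟨c, d⟩ := q
  simp only [LatticeAdj, potl, edgeTime] at *
  split_ifs with h1
  · obtain ⟨rfl, rfl⟩ := h1
    simp only [abs_eq_max_neg] at *
    omega
  · simp only [abs_eq_max_neg] at *
    omega

theorem potl_path (n : ℕ) (π : Fin (n + 1) → ℤ × ℤ) (h : IsLatticePath n π) :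
    potl (π (Fin.last n)) ≤ potl (π 0) + totalTime n π := by
  induction n with
  | zero => simp [totalTime]
  | succ n ih =>
    have h1 := ih (fun i => π i.castSucc) (fun i => h i.castSucc)
    have h2 := potl_step _ _ (h (Fin.last n))
    have h3 : totalTime (n + 1) π = totalTime n (fun i => π i.castSucc)
        + edgeTime (π (Fin.last n).castSucc) (π (Fin.last n).succ) := by
      unfold totalTime
      rw [Fin.sum_univ_castSucc]
      rfl
    have h4 : (Fin.last n).succ = Fin.last (n + 1) := rfl
    rw [h4] at h2 h3
    simp only [Fin.castSucc_zero] at h1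
    omega


/-- For all integers k and T with 1 ≤ k and 4k ≤ T, the minimum, over all
paths starting on the x-axis and ending at the vertex (k, T − 2k), of the total passage
time equals T: there is such a path of total passage time T and every such path has total
passage time at least T. -/
theorem stmt_13 (k T : ℤ) (hk : 1 ≤ k) (hkT : 4 * k ≤ T) :
    (∃ (n : ℕ) (π : Fin (n + 1) → ℤ × ℤ),
      IsLatticePath n π ∧ (π 0).2 = 0 ∧ π (Fin.last n) = (k, T - 2 * k) ∧
      totalTime n π = T) ∧
    (∀ (n : ℕ) (π : Fin (n + 1) → ℤ × ℤ),
      IsLatticePath n π → (π 0).2 = 0 → π (Fin.last n) = (k, T - 2 * k) →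
      T ≤ totalTime n π) := by
  constructor
  · obtain ⟨K, rfl⟩ := Int.eq_ofNat_of_zero_le (show 0 ≤ k by omega)
    obtain ⟨M, hM⟩ := Int.eq_ofNat_of_zero_le (show 0 ≤ T - 2 * (K : ℤ) by omega)
    rw [hM]
    refine ⟨M + K, fun i => (max 0 ((i.val : ℤ) - M), min (i.val : ℤ) M), ?_, ?_, ?_, ?_⟩
    · intro i
      simp only [LatticeAdj, Fin.val_castSucc, Fin.val_succ, abs_eq_max_neg]
      push_cast
      omega
    · simp
    · simp
    · unfold totalTime
      have : ∀ i : Fin (M + K), edgeTime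
          (max 0 ((i.castSucc.val : ℤ) - M), min (i.castSucc.val : ℤ) M)
          (max 0 ((i.succ.val : ℤ) - M), min (i.succ.val : ℤ) M)
          = (fun j : ℕ => if j < M then (1 : ℤ) else 2) i.val := by
        intro i
        simp only [edgeTime, Fin.val_castSucc, Fin.val_succ]
        push_cast
        split_ifs <;> omega
      rw [Finset.sum_congr rfl (fun i _ => this i),
        Fin.sum_univ_eq_sum_range (fun j : ℕ => if j < M then (1 : ℤ) else 2),
        Finset.sum_range_add, Finset.sum_congr rfl
          (fun j hj => if_pos (Finset.mem_range.1 hj))]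
      simp
      omega
  · intro n π h h0 h1
    have h2 := potl_path n π h
    rw [h1] at h2
    simp only [potl, h0, abs_eq_max_neg] at h2
    omega
end
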